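/- arXiv:2311.08194 — 3 statements merged into one kernel-verified Lean document; each statement's English description precedes it below -/
import Mathlib

section
/- There exists a finite simple graph that admits a rank-2 quantum 4-colouring but admits no rank-1 quantum 4-colouring. In particular, the graph parameters χ_q^{(1)} and χ_q^{(2)} are distinct. -/
open scoped ComplexConjugate

/-- The standard (conjugate-linear in the first argument) inner product on `ι → ℂ`. -/
noncomputable def cdot {ι : Type} [Fintype ι] (x y : ι → ℂ) : ℂ :=
  ∑ i, conj (x i) * y i

/-- A `k`-dimensional (complex) orthogonal representation of a graph. -/
def IsOrthRep {V : Type} (G : SimpleGraph V) (k : ℕ) (ψ : V → Fin k → ℂ) : Prop :=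
  (∀ v, cdot (ψ v) (ψ v) = 1) ∧ ∀ u v, G.Adj u v → cdot (ψ u) (ψ v) = 0

/-- The orthogonal rank `ξ(G)`: the least `k ≥ 1` admitting a `k`-dimensional
orthogonal representation. -/
noncomputable def orthRank {V : Type} (G : SimpleGraph V) : ℕ :=
  sInf {k | 1 ≤ k ∧ ∃ ψ : V → Fin k → ℂ, IsOrthRep G k ψ}

/-- A quantum `k`-colouring of `G` on `ℂ^d`: projective measurements
`{E v c}_{c ∈ Fin k}` such that `E u c * E v c = 0` for adjacent `u, v`. -/
def IsQuantumColoring {V : Type} (G : SimpleGraph V) (k d : ℕ)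
    (E : V → Fin k → Matrix (Fin d) (Fin d) ℂ) : Prop :=
  (∀ v c, (E v c).IsHermitian) ∧
  (∀ v c, E v c * E v c = E v c) ∧
  (∀ v, ∑ c, E v c = 1) ∧
  ∀ u v, G.Adj u v → ∀ c, E u c * E v c = 0

/-- The quantum chromatic number `χ_q(G)`: the least `k ≥ 1` for which a quantum
`k`-colouring exists on `ℂ^d` for some `d ≥ 1`. -/
noncomputable def quantumChromaticNumber {V : Type} (G : SimpleGraph V) : ℕ :=
  sInf {k | 1 ≤ k ∧ ∃ d, 1 ≤ d ∧
    ∃ E : V → Fin k → Matrix (Fin d) (Fin d) ℂ, IsQuantumColoring G k d E}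

/-- A rank-`r` quantum `k`-colouring: a quantum `k`-colouring on `ℂ^(r*k)` in which
every projector has rank exactly `r`. -/
def IsRankRQuantumColoring {V : Type} (G : SimpleGraph V) (r k : ℕ)
    (E : V → Fin k → Matrix (Fin (r * k)) (Fin (r * k)) ℂ) : Prop :=
  IsQuantumColoring G k (r * k) E ∧ ∀ v c, (E v c).rank = r

/-- The rank-`r` quantum chromatic number `χ_q^{(r)}(G)`. -/
noncomputable def rankChromaticNumber {V : Type} (G : SimpleGraph V) (r : ℕ) : ℕ :=
  sInf {k | 1 ≤ k ∧ ∃ E : V → Fin k → Matrix (Fin (r * k)) (Fin (r * k)) ℂ,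
    IsRankRQuantumColoring G r k E}

/-- The chromatic number of `G` as a natural number: the least `k ≥ 1` for which a
proper `k`-colouring exists. -/
noncomputable def chromNat {V : Type} (G : SimpleGraph V) : ℕ :=
  sInf {k | 1 ≤ k ∧ G.Colorable k}

/-- The clique number `ω(G)`. -/
noncomputable def cliqueNum' {V : Type} (G : SimpleGraph V) : ℕ :=
  sSup {n | ∃ S : Finset V, G.IsNClique n S}

namespace RankSep

/-- The edges of the graph (37 vertices, numbered from 0). -/
def edgeList : List (ℕ × ℕ) :=
  [(2, 0), (7, 0), (7, 1), (8, 0), (8, 1), (8, 6), (9, 2), (9, 3), (9, 4), (9, 5), (9, 6), (10, 2),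
   (10, 3), (10, 4), (10, 5), (10, 6), (10, 9), (11, 1), (11, 2), (11, 3), (11, 4), (11, 5), (11, 6), (12, 2),
   (12, 3), (12, 4), (12, 5), (12, 6), (13, 4), (14, 0), (14, 13), (15, 2), (15, 4), (15, 13), (15, 14), (16, 0),
   (16, 4), (16, 14), (16, 15), (17, 6), (17, 9), (17, 12), (18, 6), (18, 7), (18, 12), (19, 7), (19, 9), (19, 17),
   (19, 18), (20, 6), (20, 7), (20, 10), (20, 12), (20, 17), (20, 19), (21, 7), (21, 8), (21, 10), (21, 12), (21, 17),
   (22, 7), (22, 11), (22, 15), (22, 16), (22, 17), (23, 1), (23, 15), (23, 16), (23, 19), (23, 20), (23, 21), (23, 22),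
   (24, 4), (24, 11), (24, 14), (24, 19), (24, 20), (24, 21), (24, 22), (24, 23), (25, 2), (25, 9), (25, 14), (25, 16),
   (25, 21), (26, 2), (26, 13), (26, 18), (27, 2), (27, 10), (27, 13), (27, 17), (27, 19), (28, 2), (28, 10), (28, 14),
   (28, 16), (28, 25), (28, 27), (29, 0), (29, 3), (29, 9), (29, 21), (29, 26), (29, 28), (30, 2), (30, 9), (30, 13),
   (30, 20), (30, 25), (30, 27), (31, 5), (31, 8), (31, 12), (31, 14), (31, 15), (32, 6), (32, 14), (32, 15), (32, 21),
   (32, 31), (33, 5), (33, 6), (33, 12), (33, 13), (33, 16), (33, 19), (33, 31), (33, 32), (34, 1), (34, 22), (34, 24),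
   (34, 28), (34, 30), (34, 31), (35, 1), (35, 5), (35, 22), (35, 24), (35, 25), (35, 27), (35, 32), (35, 34), (36, 1),
   (36, 3), (36, 5), (36, 26), (36, 32), (36, 34)]

/-- The 24 rays of the Mermin-Peres square: four consecutive rays form a basis. -/
def rayList : List (List ℤ) :=
  [[1, 1, 1, 1], [1, 1, -1, -1], [1, -1, 1, -1], [1, -1, -1, 1],
   [1, 0, 1, 0], [1, 0, -1, 0], [0, 1, 0, 1], [0, 1, 0, -1],
   [1, 1, 0, 0], [0, 0, 1, 1], [1, -1, 0, 0], [0, 0, 1, -1],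
   [0, 1, 1, 0], [1, 0, 0, 1], [1, 0, 0, -1], [0, 1, -1, 0],
   [1, 0, 0, 0], [0, 0, 1, 0], [0, 1, 0, 0], [0, 0, 0, 1],
   [1, 1, 1, -1], [1, -1, 1, 1], [1, -1, -1, -1], [1, 1, -1, 1]]

/-- For each vertex: the basis it uses, and the colour of each of the four rays. -/
def vertexList : List (ℕ × List ℕ) :=
  [(0, [0, 1, 0, 1]), (2, [0, 1, 0, 1]), (0, [1, 2, 1, 2]), (0, [2, 2, 1, 1]), (1, [1, 1, 2, 2]), (2, [2, 1, 1, 2]),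
   (3, [2, 1, 2, 1]), (3, [3, 2, 2, 3]), (3, [3, 2, 3, 2]), (0, [3, 0, 0, 3]), (0, [0, 3, 3, 0]), (2, [3, 0, 3, 0]),
   (3, [3, 0, 3, 0]), (1, [0, 2, 1, 3]), (1, [1, 0, 3, 2]), (1, [2, 3, 0, 1]), (1, [3, 2, 1, 0]), (3, [0, 2, 1, 3]),
   (3, [0, 3, 1, 2]), (3, [2, 0, 3, 1]), (3, [1, 3, 0, 2]), (3, [2, 3, 0, 1]), (4, [0, 1, 2, 3]), (4, [1, 0, 3, 2]),
   (4, [2, 3, 0, 1]), (0, [0, 3, 2, 1]), (0, [2, 0, 3, 1]), (0, [3, 0, 2, 1]), (0, [2, 1, 0, 3]), (0, [1, 3, 2, 0]),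
   (0, [2, 1, 3, 0]), (5, [0, 3, 2, 1]), (5, [3, 0, 1, 2]), (5, [1, 2, 0, 3]), (2, [3, 0, 1, 2]), (2, [1, 2, 3, 0]),
   (2, [1, 3, 2, 0])]

/-! ### A certificate checker for the non-existence of an orthogonal representation -/

/-- Derivation trees.  `wheel b a c x y`: `b` is orthogonal to `a, c, x, y`, both `a, c` are
orthogonal to both `x, y`, and `a ≠ c`; hence `x = y`.  `split a c`: either `a = c` or `a ≠ c`. -/
inductive Cert where
  | done : Cert
  | wheel : ℕ → ℕ → ℕ → ℕ → ℕ → Cert → Cert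
  | split : ℕ → ℕ → Cert → Cert → Cert

/-- Replace `y` by `x` in a list of pairs. -/
def mergeL (x y : ℕ) (l : List (ℕ × ℕ)) : List (ℕ × ℕ) :=
  l.map fun e => (bif e.1 == y then x else e.1, bif e.2 == y then x else e.2)

/-- Is the unordered pair `i, j` in the list? -/
def hasL (l : List (ℕ × ℕ)) (i j : ℕ) : Bool :=
  l.any fun e => (e.1 == i && e.2 == j) || (e.1 == j && e.2 == i)

/-- The checker; `es` are the current orthogonal pairs, `ns` the current unequal pairs. -/
def check : Cert → List (ℕ × ℕ) → List (ℕ × ℕ) → Bool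
  | .done, es, ns => (es.any fun e => e.1 == e.2) || (ns.any fun e => e.1 == e.2)
  | .wheel b a c x y t, es, ns =>
      hasL es b a && hasL es b c && hasL es b x && hasL es b y &&
      hasL es a x && hasL es a y && hasL es c x && hasL es c y &&
      (hasL es a c || hasL ns a c) && check t (mergeL x y es) (mergeL x y ns)
  | .split a c t₁ t₂, es, ns =>
      check t₁ (mergeL a c es) (mergeL a c ns) && check t₂ es ((a, c) :: ns)

theorem mergeL_sound {α : Type*} (f : ℕ → α) (R : α → α → Prop) (x y : ℕ) (h : f x = f y)
    (l : List (ℕ × ℕ)) (hl : ∀ e ∈ l, R (f e.1) (f e.2)) :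
    ∀ e ∈ mergeL x y l, R (f e.1) (f e.2) := by
  intro e he
  obtain ⟨e', he', rfl⟩ := List.mem_map.1 he
  have key : ∀ z : ℕ, f (bif z == y then x else z) = f z := by
    intro z
    by_cases hz : z = y
    · simp only [hz, beq_self_eq_true, cond_true, h]
    · rw [beq_eq_false_iff_ne.2 hz, cond_false]
  show R (f (bif e'.1 == y then x else e'.1)) (f (bif e'.2 == y then x else e'.2))
  rw [key, key]
  exact hl e' he'

theorem hasL_sound {α : Type*} (f : ℕ → α) (R : α → α → Prop) (hR : ∀ p q, R p q → R q p)
    (l : List (ℕ × ℕ)) (hl : ∀ e ∈ l, R (f e.1) (f e.2)) (i j : ℕ) (h : hasL l i j = true) :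
    R (f i) (f j) := by
  obtain ⟨e, he, h'⟩ := List.any_eq_true.1 h
  simp only [Bool.or_eq_true, Bool.and_eq_true, beq_iff_eq] at h'
  rcases h' with ⟨h1, h2⟩ | ⟨h1, h2⟩
  · rw [← h1, ← h2]; exact hl e he
  · rw [← h1, ← h2]; exact hR _ _ (hl e he)

theorem check_sound {α : Type*} (f : ℕ → α) (O : α → α → Prop) (hO : ∀ p q, O p q → O q p)
    (hirr : ∀ i, ¬ O (f i) (f i))
    (hW : ∀ b a c x y : ℕ, O (f b) (f a) → O (f b) (f c) → O (f b) (f x) → O (f b) (f y) →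
      O (f a) (f x) → O (f a) (f y) → O (f c) (f x) → O (f c) (f y) → f a ≠ f c → f x = f y)
    (t : Cert) : ∀ es ns : List (ℕ × ℕ), (∀ e ∈ es, O (f e.1) (f e.2)) →
      (∀ e ∈ ns, f e.1 ≠ f e.2) → check t es ns = true → False := by
  induction t with
  | done =>
    intro es ns hes hns h
    simp only [check, Bool.or_eq_true, List.any_eq_true, beq_iff_eq] at h
    rcases h with ⟨e, he, h⟩ | ⟨e, he, h⟩
    · have := hes e he
      rw [h] at this
      exact hirr _ this
    · exact hns e he (by rw [h])
  | wheel b a c x y t ih =>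
    intro es ns hes hns h
    simp only [check, Bool.and_eq_true, Bool.or_eq_true] at h
    obtain ⟨⟨⟨⟨⟨⟨⟨⟨⟨h1, h2⟩, h3⟩, h4⟩, h5⟩, h6⟩, h7⟩, h8⟩, h9⟩, h10⟩ := h
    have S := hasL_sound f O hO es hes
    have hne : f a ≠ f c := by
      rcases h9 with h9 | h9
      · intro hac
        have := S _ _ h9
        rw [hac] at this
        exact hirr _ this
      · exact hasL_sound f (· ≠ ·) (fun _ _ => Ne.symm) ns hns _ _ h9
    have hxy : f x = f y := hW b a c x y (S _ _ h1) (S _ _ h2) (S _ _ h3) (S _ _ h4) (S _ _ h5)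
      (S _ _ h6) (S _ _ h7) (S _ _ h8) hne
    exact ih _ _ (mergeL_sound f O x y hxy es hes) (mergeL_sound f (· ≠ ·) x y hxy ns hns) h10
  | split a c t₁ t₂ ih₁ ih₂ =>
    intro es ns hes hns h
    simp only [check, Bool.and_eq_true] at h
    by_cases hac : f a = f c
    · exact ih₁ _ _ (mergeL_sound f O a c hac es hes) (mergeL_sound f (· ≠ ·) a c hac ns hns) h.1
    · refine ih₂ _ _ hes ?_ h.2
      intro e he
      rcases List.mem_cons.1 he with rfl | he
      · exact hac
      · exact hns e he

/-- The derivation. -/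
def cert : Cert :=
 .split 9 27
 (
  .wheel 9 2 25 28 30 <|
  .wheel 9 2 28 10 25 <|
  .split 9 20
  (
   .split 9 33
   (
    .wheel 28 9 10 2 16 <|
    .wheel 9 2 4 10 12 <|
    .wheel 10 2 28 9 14 <|
    .wheel 9 2 4 10 15 <|
    .wheel 10 9 35 5 32 <|
    .wheel 2 9 10 4 23 <|
    .wheel 9 5 10 6 35 <|
    .wheel 9 10 28 2 13 <|
    .wheel 6 9 10 5 17 <|
    .wheel 11 6 22 5 24 <|
    .wheel 5 4 10 9 22 <|
    .wheel 2 4 9 10 11 <|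
    .wheel 5 9 31 10 34 <|
    .wheel 9 4 5 10 19 <|
    .wheel 10 5 9 4 6 <|
    .wheel 9 2 10 4 28 <|
    .wheel 5 4 10 9 21 <|
    .wheel 10 5 9 4 31 <|
    .wheel 10 4 9 2 5 <|
    .split 8 10
    (
     .wheel 8 0 9 2 7 <|
     .wheel 1 2 8 4 36 <|
     .wheel 4 2 18 8 26 <|
     .wheel 9 4 29 3 8 <|
     .done)
    (
     .wheel 4 8 10 1 9 <|
     .wheel 1 2 10 4 36 <|
     .wheel 1 4 10 2 3 <|
     .wheel 1 2 4 10 29 <|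
     .wheel 4 10 26 2 18 <|
     .wheel 10 0 1 2 7 <|
     .done))
   (
    .wheel 12 9 33 5 6 <|
    .wheel 5 31 33 12 32 <|
    .wheel 9 5 12 17 35 <|
    .wheel 9 19 24 17 23 <|
    .wheel 9 5 17 10 12 <|
    .wheel 15 10 14 16 31 <|
    .wheel 22 17 34 16 24 <|
    .wheel 9 5 17 10 16 <|
    .done))
  (
   .wheel 10 9 20 6 28 <|
   .wheel 17 9 20 6 19 <|
   .wheel 6 9 20 10 17 <|
   .wheel 10 6 12 2 20 <|
   .wheel 24 2 6 11 23 <|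
   .wheel 6 2 10 9 12 <|
   .wheel 16 11 15 4 22 <|
   .wheel 10 9 35 4 5 <|
   .wheel 33 4 9 13 31 <|
   .wheel 6 13 32 14 33 <|
   .wheel 10 4 14 9 16 <|
   .wheel 4 13 15 9 14 <|
   .done))
 (
  .wheel 2 9 27 10 30 <|
  .wheel 25 2 10 9 28 <|
  .wheel 9 2 10 25 27 <|
  .split 9 15
  (
   .wheel 9 14 25 13 16 <|
   .wheel 25 9 10 2 13 <|
   .wheel 2 9 25 10 14 <|
   .wheel 9 10 32 6 31 <|
   .wheel 9 6 10 5 32 <|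
   .wheel 9 2 10 4 25 <|
   .wheel 9 6 10 5 34 <|
   .wheel 10 21 24 4 5 <|
   .wheel 4 9 17 6 22 <|
   .wheel 12 6 33 2 4 <|
   .done)
  (
   .wheel 16 9 15 4 14 <|
   .wheel 4 9 25 10 16 <|
   .wheel 13 4 10 15 25 <|
   .wheel 15 10 23 21 22 <|
   .wheel 4 10 15 9 13 <|
   .wheel 10 9 33 5 6 <|
   .wheel 33 5 31 12 32 <|
   .wheel 15 12 21 17 35 <|
   .wheel 24 19 20 17 23 <|
   .wheel 9 10 17 5 15 <|
   .wheel 17 5 12 20 21 <|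
   .wheel 20 17 24 19 34 <|
   .wheel 5 10 17 9 19 <|
   .done))

theorem cert_ok : check cert edgeList [] = true := by decide +kernel

/-! ### The wheel rule for lines in a space of dimension at most four -/

section Lines

variable {H : Type*} [NormedAddCommGroup H] [InnerProductSpace ℂ H] [FiniteDimensional ℂ H]

theorem two_le_finrank_sup (A C : Submodule ℂ H) (hA : Module.finrank ℂ A = 1)
    (hC : Module.finrank ℂ C = 1) (h : A ≠ C) :
    2 ≤ Module.finrank ℂ (A ⊔ C : Submodule ℂ H) := by
  by_contra hlt
  have h1 : A = A ⊔ C := Submodule.eq_of_le_of_finrank_le le_sup_left (by omega)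
  have h2 : C = A ⊔ C := Submodule.eq_of_le_of_finrank_le le_sup_right (by omega)
  exact h (h1.trans h2.symm)

theorem finrank_sup_ortho (A C : Submodule ℂ H) (h : A ⟂ C) :
    Module.finrank ℂ (A ⊔ C : Submodule ℂ H) = Module.finrank ℂ A + Module.finrank ℂ C := by
  have := Submodule.finrank_sup_add_finrank_inf_eq A C
  rw [h.disjoint.eq_bot, finrank_bot] at this
  omega

theorem wheel_rule (hH : Module.finrank ℂ H ≤ 4) (b a c x y : Submodule ℂ H)
    (hb : Module.finrank ℂ b = 1) (ha : Module.finrank ℂ a = 1) (hc : Module.finrank ℂ c = 1)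
    (hx : Module.finrank ℂ x = 1) (hy : Module.finrank ℂ y = 1)
    (h1 : b ⟂ a) (h2 : b ⟂ c) (h3 : b ⟂ x) (h4 : b ⟂ y)
    (h5 : a ⟂ x) (h6 : a ⟂ y) (h7 : c ⟂ x) (h8 : c ⟂ y) (hne : a ≠ c) : x = y := by
  by_contra hxy
  have e1 := two_le_finrank_sup a c ha hc hne
  have e2 := two_le_finrank_sup x y hx hy hxy
  have o1 : (a ⊔ c) ⟂ (x ⊔ y) := by
    simp only [Submodule.isOrtho_sup_left, Submodule.isOrtho_sup_right]
    exact ⟨⟨h5, h7⟩, ⟨h6, h8⟩⟩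
  have o2 : b ⟂ ((a ⊔ c) ⊔ (x ⊔ y)) := by
    simp only [Submodule.isOrtho_sup_right]
    exact ⟨⟨h1, h2⟩, ⟨h3, h4⟩⟩
  have e3 := finrank_sup_ortho _ _ o1
  have e4 := finrank_sup_ortho _ _ o2
  have e5 := Submodule.finrank_le (b ⊔ ((a ⊔ c) ⊔ (x ⊔ y)))
  omega

end Lines

/-! ### The graph -/

/-- The graph on 37 vertices. -/
def gr : SimpleGraph (Fin 37) := SimpleGraph.fromRel fun u v => (u.1, v.1) ∈ edgeList

theorem edge_bound : ∀ e ∈ edgeList, e.1 < 37 ∧ e.2 < 37 ∧ e.1 ≠ e.2 := by decide +kernel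

/-- No assignment of pairwise-orthogonal lines in dimension at most four. -/
theorem no_lines {H : Type*} [NormedAddCommGroup H] [InnerProductSpace ℂ H]
    [FiniteDimensional ℂ H] (hH : Module.finrank ℂ H ≤ 4) (L : Fin 37 → Submodule ℂ H)
    (h1 : ∀ v, Module.finrank ℂ (L v) = 1) (hL : ∀ u v, gr.Adj u v → L u ⟂ L v) : False := by
  let f : ℕ → Submodule ℂ H := fun i => L (Fin.ofNat 37 i)
  refine check_sound f (fun p q => p ⟂ q) (fun p q h => h.symm) ?_ ?_ cert edgeList [] ?_ ?_ cert_ok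
  · intro i hi
    rw [Submodule.isOrtho_self] at hi
    have := h1 (Fin.ofNat 37 i)
    change L (Fin.ofNat 37 i) = ⊥ at hi
    rw [hi, finrank_bot] at this
    omega
  · intro b a c x y
    exact wheel_rule hH _ _ _ _ _ (h1 _) (h1 _) (h1 _) (h1 _) (h1 _)
  · intro e he
    obtain ⟨h2, h3, h4⟩ := edge_bound e he
    apply hL
    rw [gr, SimpleGraph.fromRel_adj]
    have e1 : (Fin.ofNat 37 e.1).1 = e.1 := Nat.mod_eq_of_lt h2
    have e2 : (Fin.ofNat 37 e.2).1 = e.2 := Nat.mod_eq_of_lt h3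
    refine ⟨fun h => h4 ?_, Or.inl ?_⟩
    · rw [← e1, ← e2, h]
    · rw [e1, e2]; exact he
  · intro e he
    simp at he

/-- There is no rank-one quantum `k`-colouring with `1 ≤ k ≤ 4`. -/
theorem no_rank_one (k : ℕ) (hk : 1 ≤ k) (hk4 : k ≤ 4)
    (E : Fin 37 → Fin k → Matrix (Fin (1 * k)) (Fin (1 * k)) ℂ)
    (hE : IsRankRQuantumColoring gr 1 k E) : False := by
  obtain ⟨⟨hH, -, -, hadj⟩, hr⟩ := hE
  let c : Fin k := ⟨0, hk⟩
  let L : Fin 37 → Submodule ℂ (EuclideanSpace ℂ (Fin (1 * k))) := fun v =>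
    LinearMap.range (Matrix.toEuclideanLin (E v c))
  refine no_lines (H := EuclideanSpace ℂ (Fin (1 * k))) (by simpa using hk4) L ?_ ?_
  · intro v
    have := Matrix.rank_eq_finrank_range_toLin (E v c) (EuclideanSpace.basisFun (Fin (1 * k)) ℂ).toBasis
      (EuclideanSpace.basisFun (Fin (1 * k)) ℂ).toBasis
    rw [hr] at this
    refine Eq.trans ?_ this.symm
    simp only [L, Matrix.toEuclideanLin_eq_toLin_orthonormal]
    rfl
  · intro u v huv
    rw [Submodule.isOrtho_iff_inner_eq]
    rintro _ ⟨x, rfl⟩ _ ⟨y, rfl⟩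
    have hz := hadj u v huv c
    rw [← LinearMap.adjoint_inner_right, ← Matrix.toEuclideanLin_conjTranspose_eq_adjoint,
      (hH u c).eq]
    have : Matrix.toEuclideanLin (E u c) (Matrix.toEuclideanLin (E v c) y) = 0 := by
      simp [Matrix.toLpLin_apply, Matrix.mulVec_mulVec, hz]
    rw [this, inner_zero_right]

/-! ### The rank-two quantum colouring -/

/-- The basis (among six) used by vertex `v`. -/
def ctx (v : ℕ) : ℕ := (vertexList.getD v (0, [])).1

/-- The colour that vertex `v` gives to the `j`-th basis vector of `ℂ⁸`. -/
def col (v j : ℕ) : ℕ := ((vertexList.getD v (0, [])).2.getD (j % 4) 0 + 2 * (j / 4)) % 4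

/-- The `j`-th vector of the `m`-th orthogonal basis of `ℂ⁸ = ℂ⁴ ⊕ ℂ⁴`, not normalized. -/
def vec (m j k : ℕ) : ℤ :=
  bif j / 4 == k / 4 then (rayList.getD (4 * m + j % 4) []).getD (k % 4) 0 else 0

/-- Integer inner product. -/
def dot (m j m' j' : ℕ) : ℤ :=
  vec m j 0 * vec m' j' 0 + vec m j 1 * vec m' j' 1 + vec m j 2 * vec m' j' 2 +
  vec m j 3 * vec m' j' 3 + vec m j 4 * vec m' j' 4 + vec m j 5 * vec m' j' 5 +
  vec m j 6 * vec m' j' 6 + vec m j 7 * vec m' j' 7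

theorem ctx_lt : ∀ v < 37, ctx v < 6 := by decide +kernel

theorem dot_self_ne : ∀ m < 6, ∀ j < 8, dot m j m j ≠ 0 := by decide +kernel

theorem dot_basis : ∀ m < 6, ∀ i < 8, ∀ j < 8, i ≠ j → dot m i m j = 0 := by decide +kernel

/-- Four times the sum of the projectors onto a basis. -/
theorem complete_int : ∀ m < 6, ∀ k < 8, ∀ l < 8,
    ((List.range 8).map fun j => vec m j k * vec m j l * (4 / dot m j m j)).sum =
      bif k == l then 4 else 0 := by decide +kernel

theorem four_div : ∀ m < 6, ∀ j < 8, 4 / dot m j m j * dot m j m j = 4 := by decide +kernel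

theorem dot_edge : ∀ e ∈ edgeList, ∀ i < 8, ∀ j < 8, col e.1 i = col e.2 j →
    dot (ctx e.1) i (ctx e.2) j = 0 := by decide +kernel

theorem col_count : ∀ v < 37, ∀ c < 4,
    ((List.range 8).filter fun j => col v j == c).length = 2 := by decide +kernel

theorem col_lt (v j : ℕ) : col v j < 4 := Nat.mod_lt _ (by norm_num)

open Matrix in
theorem rank_of_trace {n : ℕ} (A : Matrix (Fin n) (Fin n) ℂ) (hA : A * A = A) (r : ℕ)
    (ht : A.trace = r) : A.rank = r := by
  have hid : IsIdempotentElem (Matrix.toLin' A) := by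
    show Matrix.toLin' A * Matrix.toLin' A = _
    rw [Module.End.mul_eq_comp, ← Matrix.toLin'_mul, hA]
  have hp : LinearMap.IsProj (LinearMap.range (Matrix.toLin' A)) (Matrix.toLin' A) :=
    LinearMap.IsIdempotentElem.isProj_range _ hid
  have h := hp.trace
  rw [Matrix.trace_toLin'_eq, ht] at h
  have h' : r = Module.finrank ℂ (LinearMap.range (Matrix.toLin' A)) := by exact_mod_cast h
  rw [Matrix.rank, h']
  rfl

/-- The basis vectors as complex vectors. -/
noncomputable def cvec (m : ℕ) (j : Fin 8) : Fin (2 * 4) → ℂ := fun k => (vec m j.1 k.1 : ℂ)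

theorem cvec_dot (m m' : ℕ) (i j : Fin 8) :
    cvec m i ⬝ᵥ cvec m' j = (dot m i.1 m' j.1 : ℂ) := by
  show ∑ k : Fin 8, (vec m i.1 k.1 : ℂ) * (vec m' j.1 k.1 : ℂ) = _
  rw [Fin.sum_univ_eight]
  simp only [dot]
  push_cast
  rfl

/-- The rank-one projector onto a basis vector. -/
noncomputable def prj (m : ℕ) (j : Fin 8) : Matrix (Fin (2 * 4)) (Fin (2 * 4)) ℂ :=
  ((dot m j.1 m j.1 : ℤ) : ℂ)⁻¹ • Matrix.vecMulVec (cvec m j) (cvec m j)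

theorem prj_herm (m : ℕ) (j : Fin 8) : (prj m j).IsHermitian := by
  ext k l
  simp [prj, Matrix.vecMulVec, cvec, Matrix.conjTranspose_apply, mul_comm]

theorem prj_mul_zero (m m' : ℕ) (i j : Fin 8) (h : dot m i.1 m' j.1 = 0) :
    prj m i * prj m' j = 0 := by
  have : cvec m i ⬝ᵥ cvec m' j = 0 := by rw [cvec_dot, h]; simp
  simp [prj, Matrix.vecMulVec_mul_vecMulVec, this]

theorem prj_idem (m : ℕ) (hm : m < 6) (j : Fin 8) : prj m j * prj m j = prj m j := by
  have h : ((dot m j.1 m j.1 : ℤ) : ℂ) ≠ 0 := by exact_mod_cast dot_self_ne m hm j.1 j.2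
  simp only [prj, Matrix.smul_mul, Matrix.mul_smul, Matrix.vecMulVec_mul_vecMulVec, cvec_dot,
    Matrix.vecMulVec_smul, smul_smul]
  congr 1
  field_simp

theorem prj_trace (m : ℕ) (hm : m < 6) (j : Fin 8) : (prj m j).trace = 1 := by
  have h : ((dot m j.1 m j.1 : ℤ) : ℂ) ≠ 0 := by exact_mod_cast dot_self_ne m hm j.1 j.2
  rw [prj, Matrix.trace_smul, Matrix.trace_vecMulVec, cvec_dot, smul_eq_mul, inv_mul_cancel₀ h]

theorem prj_sum (m : ℕ) (hm : m < 6) : ∑ j, prj m j = 1 := by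
  ext k l
  have h := complete_int m hm k.1 k.2 l.1 l.2
  have hd : ∀ j : Fin 8, prj m j k l =
      ((vec m j.1 k.1 * vec m j.1 l.1 * (4 / dot m j.1 m j.1) : ℤ) : ℂ) / 4 := by
    intro j
    have h0 : ((dot m j.1 m j.1 : ℤ) : ℂ) ≠ 0 := by exact_mod_cast dot_self_ne m hm j.1 j.2
    have h1 : ((4 / dot m j.1 m j.1 : ℤ) : ℂ) * ((dot m j.1 m j.1 : ℤ) : ℂ) = 4 := by
      exact_mod_cast four_div m hm j.1 j.2
    rw [prj, Matrix.smul_apply, Matrix.vecMulVec_apply, smul_eq_mul, cvec, cvec]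
    rw [Int.cast_mul, Int.cast_mul, eq_div_iff (by norm_num), inv_mul_eq_div, div_mul_eq_mul_div,
      div_eq_iff h0, ← h1]
    ring
  rw [Matrix.sum_apply, Finset.sum_congr rfl fun j _ => hd j, ← Finset.sum_div, ← Int.cast_sum]
  have hs : ∑ j : Fin 8, (vec m j.1 k.1 * vec m j.1 l.1 * (4 / dot m j.1 m j.1)) =
      bif k.1 == l.1 then 4 else 0 := by
    rw [← h, Fin.sum_univ_eight]
    simp only [List.range_succ, List.range_zero, List.map_append, List.map_nil, List.map_cons,
      List.sum_append, List.sum_nil, List.sum_cons]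
    simp
  rw [hs]
  by_cases hkl : k = l
  · subst hkl
    simp
  · have : k.1 ≠ l.1 := fun h => hkl (Fin.ext h)
    rw [beq_eq_false_iff_ne.2 this, Matrix.one_apply_ne hkl]
    simp

/-- The rank-two quantum colouring. -/
noncomputable def qc (v : Fin 37) (c : Fin 4) : Matrix (Fin (2 * 4)) (Fin (2 * 4)) ℂ :=
  ∑ j : Fin 8 with col v.1 j.1 = c.1, prj (ctx v.1) j

theorem qc_idem (v : Fin 37) (c : Fin 4) : qc v c * qc v c = qc v c := by
  rw [qc, Finset.sum_mul]
  refine Finset.sum_congr rfl fun i hi => ?_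
  rw [Finset.mul_sum, Finset.sum_eq_single_of_mem i hi]
  · exact prj_idem _ (ctx_lt _ v.2) i
  · intro j _ hj
    exact prj_mul_zero _ _ _ _ (dot_basis _ (ctx_lt _ v.2) _ i.2 _ j.2
      fun h => hj (Fin.ext h.symm))

theorem qc_herm (v : Fin 37) (c : Fin 4) : (qc v c).IsHermitian := by
  rw [Matrix.IsHermitian, qc, Matrix.conjTranspose_sum]
  exact Finset.sum_congr rfl fun i _ => prj_herm _ i

theorem qc_edge (u v : Fin 37) (c : Fin 4) (h : (u.1, v.1) ∈ edgeList) :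
    qc u c * qc v c = 0 := by
  rw [qc, qc, Finset.sum_mul]
  refine Finset.sum_eq_zero fun i hi => ?_
  rw [Finset.mul_sum]
  refine Finset.sum_eq_zero fun j hj => ?_
  simp only [Finset.mem_filter, Finset.mem_univ, true_and] at hi hj
  exact prj_mul_zero _ _ _ _ (dot_edge _ h _ i.2 _ j.2 (hi.trans hj.symm))

theorem qc_card : ∀ (v : Fin 37) (c : Fin 4),
    (Finset.univ.filter fun j : Fin 8 => col v.1 j.1 = c.1).card = 2 := by decide +kernel

theorem qc_rank (v : Fin 37) (c : Fin 4) : (qc v c).rank = 2 := by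
  refine rank_of_trace _ (qc_idem v c) 2 ?_
  rw [qc, Matrix.trace_sum, Finset.sum_congr rfl fun j _ => prj_trace _ (ctx_lt _ v.2) j]
  rw [Finset.sum_const, qc_card]
  norm_num

theorem qc_sum (v : Fin 37) : ∑ c, qc v c = 1 := by
  rw [← prj_sum _ (ctx_lt _ v.2)]
  have := Finset.sum_fiberwise (s := Finset.univ)
    (g := fun j : Fin 8 => (⟨col v.1 j.1, col_lt _ _⟩ : Fin 4)) (f := fun j => prj (ctx v.1) j)
  rw [← this]
  refine Finset.sum_congr rfl fun c _ => ?_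
  rw [qc]
  refine Finset.sum_congr ?_ fun _ _ => rfl
  ext j
  simp [Fin.ext_iff]

theorem qc_ok : IsRankRQuantumColoring gr 2 4 qc := by
  refine ⟨⟨qc_herm, qc_idem, qc_sum, ?_⟩, qc_rank⟩
  intro u v huv c
  rw [gr, SimpleGraph.fromRel_adj] at huv
  rcases huv.2 with h | h
  · exact qc_edge u v c h
  · have := congrArg Matrix.conjTranspose (qc_edge v u c h)
    rwa [Matrix.conjTranspose_mul, (qc_herm u c).eq, (qc_herm v c).eq,
      Matrix.conjTranspose_zero] at this

end RankSep

/-- there is a finite simple graph admitting a rank-2 quantum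
4-colouring but no rank-1 quantum 4-colouring; in particular the parameters
`χ_q^{(1)}` and `χ_q^{(2)}` are distinct. -/
theorem rank_one_rank_two_distinct :
    ∃ (V : Type) (_ : Fintype V) (G : SimpleGraph V),
      (∃ E : V → Fin 4 → Matrix (Fin (2 * 4)) (Fin (2 * 4)) ℂ,
        IsRankRQuantumColoring G 2 4 E) ∧
      (¬ ∃ E : V → Fin 4 → Matrix (Fin (1 * 4)) (Fin (1 * 4)) ℂ,
        IsRankRQuantumColoring G 1 4 E) ∧
      rankChromaticNumber G 1 ≠ rankChromaticNumber G 2 := by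
  refine ⟨Fin 37, inferInstance, RankSep.gr, ⟨RankSep.qc, RankSep.qc_ok⟩, ?_, ?_⟩
  · rintro ⟨E, hE⟩
    exact RankSep.no_rank_one 4 (by norm_num) le_rfl E hE
  · intro h
    have h2 : (4 : ℕ) ∈ {k | 1 ≤ k ∧ ∃ E : Fin 37 → Fin k → Matrix (Fin (2 * k)) (Fin (2 * k)) ℂ,
        IsRankRQuantumColoring RankSep.gr 2 k E} :=
      ⟨by norm_num, RankSep.qc, RankSep.qc_ok⟩
    have hle : rankChromaticNumber RankSep.gr 2 ≤ 4 := Nat.sInf_le h2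
    have hge : 1 ≤ rankChromaticNumber RankSep.gr 2 := (Nat.sInf_mem ⟨4, h2⟩).1
    rw [← h] at hle hge
    have hne : {k | 1 ≤ k ∧ ∃ E : Fin 37 → Fin k → Matrix (Fin (1 * k)) (Fin (1 * k)) ℂ,
        IsRankRQuantumColoring RankSep.gr 1 k E}.Nonempty :=
      Nat.nonempty_of_pos_sInf hge
    obtain ⟨h3, E, hE⟩ := Nat.sInf_mem hne
    exact RankSep.no_rank_one _ h3 hle E hE
end

section
/- There exists a simple graph G on 21 vertices such that: G has clique number 4; G admits a rank-2 quantum 4-colouring (hence χ_q(G) = χ_q^{(2)}(G) = 4); the chromatic number of G is 5; and G admits no 4-dimensional complex orthogonal representation (hence the orthogonal rank of G is 5 and χ_q^{(1)}(G) = 5). -/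
open scoped ComplexConjugate

/-- First observable (up to sign) attached to each vertex. -/
def obsA : Fin 21 → ℤ :=
  ![1, 2, -2, -2, -3, 2, 3, -1, 1, -4, -1, 1, -2, 4, -1, -2, -2, -4, 2, -1, 4]

/-- Second observable. -/
def obsB : Fin 21 → ℤ :=
  ![-5, -6, -6, -7, 7, -7, 7, 7, 8, 6, 5, 5, 8, -5, -8, 6, -8, -5, 6, -7, -6]

/-- Third observable. -/
def obsC : Fin 21 → ℤ :=
  ![-9, -9, 9, 10, -9, -10, 9, -11, 12, -12, -9, 9, -13, 13, 12, -9, 13, -13, 9, 11, -12]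

/-- The graph: two vertices are adjacent when they carry the same observable of the same
type with opposite signs. -/
def G21 : SimpleGraph (Fin 21) where
  Adj u v := obsA u = -obsA v ∨ obsB u = -obsB v ∨ obsC u = -obsC v
  symm := ⟨by intro u v h; omega⟩
  loopless := ⟨by decide⟩

instance : DecidableRel G21.Adj := fun u v =>
  inferInstanceAs (Decidable (obsA u = -obsA v ∨ obsB u = -obsB v ∨ obsC u = -obsC v))

set_option maxHeartbeats 4000000 in
/-- Combinatorial core: `q v i` says that the `i`-th coordinate of the vector of `v` vanishes. -/
theorem core (q : Fin 21 → Fin 4 → Prop)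
    (N : ∀ v, ¬ (q v 0 ∧ q v 1 ∧ q v 2 ∧ q v 3))
    (K : ∀ u v, G21.Adj u v → ∀ i, (∀ j, j ≠ i → q u j ∨ q v j) → q u i ∨ q v i)
    (b0 : ∀ v, G21.Adj 1 v → q v 0) (b1 : ∀ v, G21.Adj 2 v → q v 1)
    (b2 : ∀ v, G21.Adj 15 v → q v 2) (b3 : ∀ v, G21.Adj 18 v → q v 3) : False := by
  have K0 : ∀ u v, G21.Adj u v → (q u 1 ∨ q v 1) → (q u 2 ∨ q v 2) → (q u 3 ∨ q v 3) →
      q u 0 ∨ q v 0 := fun u v h h1 h2 h3 => K u v h 0 (by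
        intro j hj; fin_cases j <;> first | assumption | exact absurd rfl hj)
  have K1 : ∀ u v, G21.Adj u v → (q u 0 ∨ q v 0) → (q u 2 ∨ q v 2) → (q u 3 ∨ q v 3) →
      q u 1 ∨ q v 1 := fun u v h h1 h2 h3 => K u v h 1 (by
        intro j hj; fin_cases j <;> first | assumption | exact absurd rfl hj)
  have K2 : ∀ u v, G21.Adj u v → (q u 0 ∨ q v 0) → (q u 1 ∨ q v 1) → (q u 3 ∨ q v 3) →
      q u 2 ∨ q v 2 := fun u v h h1 h2 h3 => K u v h 2 (by
        intro j hj; fin_cases j <;> first | assumption | exact absurd rfl hj)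
  have K3 : ∀ u v, G21.Adj u v → (q u 0 ∨ q v 0) → (q u 1 ∨ q v 1) → (q u 2 ∨ q v 2) →
      q u 3 ∨ q v 3 := fun u v h h1 h2 h3 => K u v h 3 (by
        intro j hj; fin_cases j <;> first | assumption | exact absurd rfl hj)
  clear K
  -- vectors lying in coordinate planes
  have z3 : q 3 0 ∧ q 3 3 := ⟨b0 3 (by decide), b3 3 (by decide)⟩
  have z4 : q 4 1 ∧ q 4 3 := ⟨b1 4 (by decide), b3 4 (by decide)⟩
  have z5 : q 5 1 ∧ q 5 2 := ⟨b1 5 (by decide), b2 5 (by decide)⟩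
  have z6 : q 6 0 ∧ q 6 2 := ⟨b0 6 (by decide), b2 6 (by decide)⟩
  have z0 : q 0 1 ∧ q 0 3 := ⟨b1 0 (by decide), b3 0 (by decide)⟩
  have z10 : q 10 1 ∧ q 10 3 := ⟨b1 10 (by decide), b3 10 (by decide)⟩
  have z11 : q 11 0 ∧ q 11 2 := ⟨b0 11 (by decide), b2 11 (by decide)⟩
  have z12 : q 12 0 ∧ q 12 3 := ⟨b0 12 (by decide), b3 12 (by decide)⟩
  have z16 : q 16 0 ∧ q 16 3 := ⟨b0 16 (by decide), b3 16 (by decide)⟩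
  have z9 : q 9 0 ∧ q 9 1 := ⟨b0 9 (by decide), b1 9 (by decide)⟩
  have z20 : q 20 2 ∧ q 20 3 := ⟨b2 20 (by decide), b3 20 (by decide)⟩
  clear b0 b1 b2 b3
  -- first square: vertices 3, 4, 5, 6
  have sq1 : (q 3 1 ∧ q 4 2 ∧ q 5 0 ∧ q 6 3) ∨ (q 3 2 ∧ q 4 0 ∧ q 5 3 ∧ q 6 1) := by
    have e1 := K2 3 4 (by decide) (.inl z3.1) (.inr z4.1) (.inl z3.2)
    have e2 := K1 3 6 (by decide) (.inl z3.1) (.inr z6.2) (.inl z3.2)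
    have e3 := K0 5 4 (by decide) (.inl z5.1) (.inl z5.2) (.inr z4.2)
    have e4 := K3 5 6 (by decide) (.inr z6.1) (.inl z5.1) (.inl z5.2)
    have n3 := N 3
    have n4 := N 4
    have n5 := N 5
    have n6 := N 6
    clear K0 K1 K2 K3 N
    grind
  have n3 := N 3
  have n4 := N 4
  have n5 := N 5
  have n6 := N 6
  have sq2 : (q 7 2 ∧ q 7 3 ∧ q 19 0 ∧ q 19 1) ∨ (q 7 0 ∧ q 7 1 ∧ q 19 2 ∧ q 19 3) := by
    rcases sq1 with ⟨h1, h2, h3, h4⟩ | ⟨h1, h2, h3, h4⟩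
    · left
      have e1 := K2 7 3 (by decide) (.inr z3.1) (.inr h1) (.inr z3.2)
      have e2 := K3 7 5 (by decide) (.inr h3) (.inr z5.1) (.inr z5.2)
      have e3 := K0 19 4 (by decide) (.inr z4.1) (.inr h2) (.inr z4.2)
      have e4 := K1 19 6 (by decide) (.inr z6.1) (.inr z6.2) (.inr h4)
      clear K0 K1 K2 K3 N
      grind
    · right
      have e1 := K1 7 3 (by decide) (.inr z3.1) (.inr h1) (.inr z3.2)
      have e2 := K0 7 5 (by decide) (.inr z5.1) (.inr z5.2) (.inr h3)
      have e3 := K2 19 4 (by decide) (.inr h2) (.inr z4.1) (.inr z4.2)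
      have e4 := K3 19 6 (by decide) (.inr z6.1) (.inr h4) (.inr z6.2)
      clear K0 K1 K2 K3 N
      grind
  clear n3 n4 n5 n6 sq1 z3 z4 z5 z6
  have sq3 : (q 0 0 ∧ q 11 3 ∧ ((q 7 1 ∧ q 7 2 ∧ q 7 3 ∧ q 19 0 ∧ q 19 1 ∧ q 19 2) ∨
        (q 19 1 ∧ q 19 2 ∧ q 19 3 ∧ q 7 0 ∧ q 7 1 ∧ q 7 2))) ∨
      (q 0 2 ∧ q 11 1 ∧ ((q 7 0 ∧ q 7 2 ∧ q 7 3 ∧ q 19 0 ∧ q 19 1 ∧ q 19 3) ∨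
        (q 19 0 ∧ q 19 2 ∧ q 19 3 ∧ q 7 0 ∧ q 7 1 ∧ q 7 3))) := by
    have e1 := K0 7 0 (by decide) (.inr z0.1)
    have e2 := K2 7 0 (by decide)
    have e3 := K0 19 0 (by decide) (.inr z0.1)
    have e4 := K2 19 0 (by decide)
    have e5 := K1 7 11 (by decide) (.inr z11.1) (.inr z11.2)
    have e6 := K3 7 11 (by decide) (.inr z11.1)
    have e7 := K1 19 11 (by decide) (.inr z11.1) (.inr z11.2)
    have e8 := K3 19 11 (by decide) (.inr z11.1)
    have n0 := N 0
    have n11 := N 11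
    have n7 := N 7
    have n19 := N 19
    clear K0 K1 K2 K3 N
    rcases sq2 with ⟨h1, h2, h3, h4⟩ | ⟨h1, h2, h3, h4⟩
    · grind
    · grind
  clear sq2
  -- a vector supported on a single coordinate kills that coordinate of all its neighbours
  have S0 : ∀ u v, G21.Adj u v → q u 1 → q u 2 → q u 3 → q v 0 := fun u v h h1 h2 h3 =>
    (K0 u v h (.inl h1) (.inl h2) (.inl h3)).resolve_left fun h0 => N u ⟨h0, h1, h2, h3⟩
  have S1 : ∀ u v, G21.Adj u v → q u 0 → q u 2 → q u 3 → q v 1 := fun u v h h1 h2 h3 =>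
    (K1 u v h (.inl h1) (.inl h2) (.inl h3)).resolve_left fun h0 => N u ⟨h1, h0, h2, h3⟩
  have S2 : ∀ u v, G21.Adj u v → q u 0 → q u 1 → q u 3 → q v 2 := fun u v h h1 h2 h3 =>
    (K2 u v h (.inl h1) (.inl h2) (.inl h3)).resolve_left fun h0 => N u ⟨h1, h2, h0, h3⟩
  have S3 : ∀ u v, G21.Adj u v → q u 0 → q u 1 → q u 2 → q v 3 := fun u v h h1 h2 h3 =>
    (K3 u v h (.inl h1) (.inl h2) (.inl h3)).resolve_left fun h0 => N u ⟨h1, h2, h3, h0⟩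
  have a010 : G21.Adj 0 10 := by decide
  have a78 : G21.Adj 7 8 := by decide
  have a198 : G21.Adj 19 8 := by decide
  have a014 : G21.Adj 0 14 := by decide
  have a1114 : G21.Adj 11 14 := by decide
  have a1013 : G21.Adj 10 13 := by decide
  have a1113 : G21.Adj 11 13 := by decide
  have a1017 : G21.Adj 10 17 := by decide
  have a1117 : G21.Adj 11 17 := by decide
  have a98 : G21.Adj 9 8 := by decide
  have a914 : G21.Adj 9 14 := by decide
  have a208 : G21.Adj 20 8 := by decide
  have a2014 : G21.Adj 20 14 := by decide
  have a816 : G21.Adj 8 16 := by decide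
  have a1612 : G21.Adj 16 12 := by decide
  have a1412 : G21.Adj 14 12 := by decide
  have a1617 : G21.Adj 16 17 := by decide
  have a1713 : G21.Adj 17 13 := by decide
  have a913 : G21.Adj 9 13 := by decide
  have a1213 : G21.Adj 12 13 := by decide
  have a2017 : G21.Adj 20 17 := by decide
  obtain ⟨z01, z03⟩ := z0
  obtain ⟨z101, z103⟩ := z10
  obtain ⟨z110, z112⟩ := z11
  obtain ⟨z120, z123⟩ := z12
  obtain ⟨z160, z163⟩ := z16
  obtain ⟨z90, z91⟩ := z9
  obtain ⟨z202, z203⟩ := z20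
  rcases sq3 with ⟨h0, h11, h⟩ | ⟨h0, h11, h⟩
  · have h10 : q 10 2 := S2 0 10 a010 h0 z01 z03
    have h8 : q 8 0 ∧ q 8 3 := by
      rcases h with ⟨p1, p2, p3, p4, p5, p6⟩ | ⟨p1, p2, p3, p4, p5, p6⟩
      · exact ⟨S0 7 8 a78 p1 p2 p3, S3 19 8 a198 p4 p5 p6⟩
      · exact ⟨S0 19 8 a198 p1 p2 p3, S3 7 8 a78 p4 p5 p6⟩
    have h142 : q 14 2 := S2 0 14 a014 h0 z01 z03
    have h141 : q 14 1 := S1 11 14 a1114 z110 z112 h11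
    have h130 : q 13 0 := S0 10 13 a1013 z101 h10 z103
    have h131 : q 13 1 := S1 11 13 a1113 z110 z112 h11
    have h170 : q 17 0 := S0 10 17 a1017 z101 h10 z103
    have h171 : q 17 1 := S1 11 17 a1117 z110 z112 h11
    have c1 : q 9 2 ∨ q 8 2 := K2 9 8 a98 (.inl z90) (.inl z91) (.inr h8.2)
    have c2 : q 9 3 ∨ q 14 3 := K3 9 14 a914 (.inl z90) (.inl z91) (.inr h142)
    have c3 : q 20 1 ∨ q 8 1 := K1 20 8 a208 (.inr h8.1) (.inl z202) (.inl z203)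
    have c4 : q 20 0 ∨ q 14 0 := K0 20 14 a2014 (.inr h141) (.inl z202) (.inl z203)
    rcases c1 with c1 | c1
    · -- `v9 = e3`, `v14 = e0`, `v20 = e1`, `v8 = e2`
      have d14 : q 14 3 := c2.resolve_left fun t => N 9 ⟨z90, z91, c1, t⟩
      have d20 : q 20 0 := c4.resolve_right fun t => N 14 ⟨t, h141, h142, d14⟩
      have d8 : q 8 1 := c3.resolve_left fun t => N 20 ⟨d20, t, z202, z203⟩
      have d16 : q 16 2 := S2 8 16 a816 h8.1 d8 h8.2
      have d12 : q 12 1 := S1 16 12 a1612 z160 d16 z163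
      have d13 : q 13 2 := S2 12 13 a1213 z120 d12 z123
      have d13' : q 13 3 := S3 9 13 a913 z90 z91 c1
      exact N 13 ⟨h130, h131, d13, d13'⟩
    · -- `v8 = e1`, `v20 = e0`, `v14 = e3`, `v9 = e2`
      have d20 : q 20 1 := c3.resolve_right fun t => N 8 ⟨h8.1, t, c1, h8.2⟩
      have d14 : q 14 0 := c4.resolve_left fun t => N 20 ⟨t, d20, z202, z203⟩
      have d9 : q 9 3 := c2.resolve_right fun t => N 14 ⟨d14, h141, h142, t⟩
      have d16 : q 16 1 := S1 8 16 a816 h8.1 c1 h8.2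
      have d17 : q 17 2 := S2 16 17 a1617 z160 d16 z163
      have d13 : q 13 3 := S3 17 13 a1713 h170 h171 d17
      have d13' : q 13 2 := S2 9 13 a913 z90 z91 d9
      exact N 13 ⟨h130, h131, d13', d13⟩
  · have h10 : q 10 0 := S0 0 10 a010 z01 h0 z03
    have h8 : q 8 1 ∧ q 8 2 := by
      rcases h with ⟨p1, p2, p3, p4, p5, p6⟩ | ⟨p1, p2, p3, p4, p5, p6⟩
      · exact ⟨S1 7 8 a78 p1 p2 p3, S2 19 8 a198 p4 p5 p6⟩
      · exact ⟨S1 19 8 a198 p1 p2 p3, S2 7 8 a78 p4 p5 p6⟩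
    have h140 : q 14 0 := S0 0 14 a014 z01 h0 z03
    have h143 : q 14 3 := S3 11 14 a1114 z110 h11 z112
    have h132 : q 13 2 := S2 10 13 a1013 h10 z101 z103
    have h133 : q 13 3 := S3 11 13 a1113 z110 h11 z112
    have h172 : q 17 2 := S2 10 17 a1017 h10 z101 z103
    have h173 : q 17 3 := S3 11 17 a1117 z110 h11 z112
    have c1 : q 9 3 ∨ q 8 3 := K3 9 8 a98 (.inl z90) (.inl z91) (.inr h8.2)
    have c2 : q 9 2 ∨ q 14 2 := K2 9 14 a914 (.inl z90) (.inl z91) (.inr h143)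
    have c3 : q 20 0 ∨ q 8 0 := K0 20 8 a208 (.inr h8.1) (.inl z202) (.inl z203)
    have c4 : q 20 1 ∨ q 14 1 := K1 20 14 a2014 (.inr h140) (.inl z202) (.inl z203)
    rcases c1 with c1 | c1
    · -- `v9 = e2`, `v14 = e1`, `v20 = e0`
      have d14 : q 14 2 := c2.resolve_left fun t => N 9 ⟨z90, z91, t, c1⟩
      have d20 : q 20 1 := c4.resolve_right fun t => N 14 ⟨h140, t, d14, h143⟩
      have d12 : q 12 1 := S1 14 12 a1412 h140 d14 h143
      have d16 : q 16 2 := S2 12 16 a1612.symm z120 d12 z123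
      have d17 : q 17 1 := S1 16 17 a1617 z160 d16 z163
      have d17' : q 17 0 := S0 20 17 a2017 d20 z202 z203
      exact N 17 ⟨d17', d17, h172, h173⟩
    · -- `v8 = e0`, `v20 = e1`, `v14 = e2`
      have d20 : q 20 0 := c3.resolve_right fun t => N 8 ⟨t, h8.1, h8.2, c1⟩
      have d14 : q 14 1 := c4.resolve_left fun t => N 20 ⟨d20, t, z202, z203⟩
      have d17 : q 17 1 := S1 20 17 a2017 d20 z202 z203
      have d13 : q 13 0 := S0 17 13 a1713 d17 h172 h173
      have d12 : q 12 1 := S1 13 12 a1213.symm d13 h132 h133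
      have d12' : q 12 2 := S2 14 12 a1412 h140 d14 h143
      exact N 12 ⟨z120, d12, d12', z123⟩

/-- Vertices of the clique used as a basis. -/
def bas : Fin 4 → Fin 21 := ![1, 2, 15, 18]

theorem bas_adj : ∀ i j, i ≠ j → G21.Adj (bas i) (bas j) := by decide

theorem no_rep : ¬ ∃ ψ : Fin 21 → Fin 4 → ℂ, IsOrthRep G21 4 ψ := by
  rintro ⟨ψ, h1, h2⟩
  let B : Matrix (Fin 4) (Fin 4) ℂ := Matrix.of fun i j => conj (ψ (bas i) j)
  have hB : B * B.conjTranspose = 1 := by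
    ext i j
    have : (B * B.conjTranspose) i j = cdot (ψ (bas i)) (ψ (bas j)) := by
      rw [Matrix.mul_apply]
      exact Finset.sum_congr rfl fun x _ => congrArg _ (Complex.conj_conj _)
    rw [this]
    by_cases hij : i = j
    · subst hij; simp [h1]
    · rw [h2 _ _ (bas_adj i j hij), Matrix.one_apply_ne hij]
  have hB' : B.conjTranspose * B = 1 := mul_eq_one_comm.mp hB
  let z : Fin 21 → Fin 4 → ℂ := fun v i => cdot (ψ (bas i)) (ψ v)
  have hz : ∀ v, z v = B.mulVec (ψ v) := by
    intro v; ext i; simp [z, B, cdot, Matrix.mulVec, dotProduct]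
  have cd : ∀ x y : Fin 4 → ℂ, cdot x y = star x ⬝ᵥ y := by
    intro x y; simp [cdot, dotProduct]
  have par : ∀ u v, cdot (z u) (z v) = cdot (ψ u) (ψ v) := by
    intro u v
    rw [cd, cd, hz, hz, Matrix.star_mulVec, ← Matrix.dotProduct_mulVec, Matrix.mulVec_mulVec, hB',
      Matrix.one_mulVec]
  have bb : ∀ i v, G21.Adj (bas i) v → z v i = 0 := fun i v h => h2 _ _ h
  refine core (fun v i => z v i = 0) ?_ ?_ (bb 0) (bb 1) (bb 2) (bb 3)
  · rintro v ⟨a0, a1, a2, a3⟩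
    have := par v v
    rw [h1, cdot, Fin.sum_univ_four, a0, a1, a2, a3] at this
    simp at this
  · intro u v huv i hi
    have := par u v
    rw [h2 u v huv, cdot, Finset.sum_eq_single i] at this
    · simpa using this
    · intro j _ hj
      rcases hi j hj with h | h <;> simp [h]
    · simp

/-- The trace of an idempotent matrix is its rank. -/
theorem trace_idem {d : ℕ} (P : Matrix (Fin d) (Fin d) ℂ) (h : P * P = P) :
    P.trace = (P.rank : ℂ) := by
  have hp : LinearMap.IsProj (LinearMap.range (Matrix.toLin' P)) (Matrix.toLin' P) := by
    refine ⟨fun x => ⟨x, rfl⟩, ?_⟩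
    rintro _ ⟨y, rfl⟩
    simp [Matrix.toLin'_apply, Matrix.mulVec_mulVec, h]
  have := hp.trace
  rw [Matrix.trace_toLin'_eq] at this
  rw [this]
  rfl

/-- Cliques have size at most the number of colours of a quantum colouring. -/
theorem clique_le {G : SimpleGraph (Fin 21)} {k d : ℕ} (hd : 1 ≤ d)
    {E : Fin 21 → Fin k → Matrix (Fin d) (Fin d) ℂ} (hE : IsQuantumColoring G k d E)
    (S : Finset (Fin 21)) (hS : G.IsClique S) : S.card ≤ k := by
  obtain ⟨-, hi, hs, ho⟩ := hE
  have idem : ∀ c, (∑ v ∈ S, E v c) * (∑ v ∈ S, E v c) = ∑ v ∈ S, E v c := by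
    intro c
    rw [Finset.sum_mul]
    refine Finset.sum_congr rfl fun u hu => ?_
    rw [Finset.mul_sum, Finset.sum_eq_single u]
    · exact hi u c
    · intro v hv hne
      exact ho u v (hS hu hv hne.symm) c
    · exact fun h => absurd hu h
  have tot : ∑ c, (∑ v ∈ S, E v c).trace = (S.card : ℂ) * d := by
    rw [← Matrix.trace_sum, Finset.sum_comm]
    simp only [hs]
    rw [Matrix.trace_sum]
    simp [Matrix.trace_one]
  have tot' : ∑ c, (∑ v ∈ S, E v c).rank = S.card * d := by
    have : ((∑ c, (∑ v ∈ S, E v c).rank : ℕ) : ℂ) = (S.card * d : ℕ) := by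
      push_cast
      rw [← tot]
      exact Finset.sum_congr rfl fun c _ => (trace_idem _ (idem c)).symm
    exact_mod_cast this
  have le : ∑ c : Fin k, (∑ v ∈ S, E v c).rank ≤ ∑ _c : Fin k, d :=
    Finset.sum_le_sum fun c _ => by simpa using Matrix.rank_le_width (∑ v ∈ S, E v c)
  rw [tot'] at le
  simp only [Finset.sum_const, Finset.card_univ, Fintype.card_fin, smul_eq_mul] at le
  exact Nat.le_of_mul_le_mul_right le hd

/-- Data `(x, z, sign)` of the thirteen Pauli-type observables. -/
def pauli : ℕ → ℕ × ℕ × ℤ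
  | 1 => (7, 0, 1)
  | 2 => (0, 4, 1)
  | 3 => (3, 3, -1)
  | 4 => (6, 1, 1)
  | 5 => (5, 5, 1)
  | 6 => (2, 1, 1)
  | 7 => (1, 6, 1)
  | 8 => (3, 0, 1)
  | 9 => (2, 5, 1)
  | 10 => (1, 2, 1)
  | 11 => (6, 6, 1)
  | 12 => (4, 0, 1)
  | _ => (3, 4, 1)

/-- Parity character of a three-bit number. -/
def par3 (m : ℕ) : ℤ := (-1) ^ (m % 2 + m / 2 % 2 + m / 4 % 2)

/-- The signed observable with label `n`, as an integer matrix. -/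
def obs (n : ℤ) : Matrix (Fin (2 * 4)) (Fin (2 * 4)) ℤ := fun i j =>
  if i.val ^^^ j.val = (pauli n.natAbs).1 then
    n.sign * ((pauli n.natAbs).2.2 * par3 (j.val &&& (pauli n.natAbs).2.1)) else 0

theorem obs_neg (n : ℤ) : obs (-n) = -obs n := by
  ext i j
  simp only [obs, Int.natAbs_neg, Int.sign_neg, Matrix.neg_apply]
  split <;> simp

theorem obs_symA : ∀ v : Fin 21, obs (obsA v) = (obs (obsA v)).transpose := by
  decide +kernel

theorem obs_symB : ∀ v : Fin 21, obs (obsB v) = (obs (obsB v)).transpose := by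
  decide +kernel

theorem obs_AA : ∀ v : Fin 21, obs (obsA v) * obs (obsA v) = 1 := by
  decide +kernel

theorem obs_BB : ∀ v : Fin 21, obs (obsB v) * obs (obsB v) = 1 := by
  decide +kernel

theorem obs_AB : ∀ v : Fin 21, obs (obsA v) * obs (obsB v) = obs (obsC v) := by
  decide +kernel

theorem obs_BA : ∀ v : Fin 21, obs (obsB v) * obs (obsA v) = obs (obsC v) := by
  decide +kernel

theorem obs_trA : ∀ v : Fin 21, ∑ i, obs (obsA v) i i = 0 := by
  decide +kernel

theorem obs_trB : ∀ v : Fin 21, ∑ i, obs (obsB v) i i = 0 := by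
  decide +kernel

theorem obs_trC : ∀ v : Fin 21, ∑ i, obs (obsC v) i i = 0 := by
  decide +kernel

/-- Complex version of the observables. -/
noncomputable def cobs (n : ℤ) : Matrix (Fin (2 * 4)) (Fin (2 * 4)) ℂ :=
  (obs n).map (Int.castRingHom ℂ)

theorem cobs_neg (n : ℤ) : cobs (-n) = -cobs n := by
  rw [cobs, obs_neg]; ext; simp [cobs]

theorem cobs_herm (n : ℤ) (h : obs n = (obs n).transpose) : (cobs n).IsHermitian := by
  ext i j
  have h' : obs n i j = obs n j i := congrFun (congrFun h i) j
  simp [cobs, Matrix.conjTranspose_apply, h']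

theorem cobs_mul (a b : ℤ) : cobs a * cobs b = (obs a * obs b).map (Int.castRingHom ℂ) := by
  rw [Matrix.map_mul]; rfl

theorem cobs_trace (n : ℤ) (h : ∑ i, obs n i i = 0) : (cobs n).trace = 0 := by
  have : (cobs n).trace = ((∑ i, obs n i i : ℤ) : ℂ) := by
    simp [Matrix.trace, cobs]
  rw [this, h]; simp

/-- Signs. -/
noncomputable def sA : Fin 4 → ℂ := ![1, 1, -1, -1]
/-- Signs. -/
noncomputable def sB : Fin 4 → ℂ := ![1, -1, 1, -1]

theorem sA_pm (c : Fin 4) : sA c = 1 ∨ sA c = -1 := by fin_cases c <;> simp [sA]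
theorem sB_pm (c : Fin 4) : sB c = 1 ∨ sB c = -1 := by fin_cases c <;> simp [sB]

/-- Joint spectral projector. -/
noncomputable def proj (s t : ℂ) (A B C : Matrix (Fin (2 * 4)) (Fin (2 * 4)) ℂ) :
    Matrix (Fin (2 * 4)) (Fin (2 * 4)) ℂ :=
  (1 / 4 : ℂ) • (1 + s • A + t • B + (s * t) • C)

/-- A line: three commuting involutions with product one. -/
structure IsLine (A B C : Matrix (Fin (2 * 4)) (Fin (2 * 4)) ℂ) : Prop where
  hA : A.IsHermitian
  hB : B.IsHermitian
  AA : A * A = 1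
  BB : B * B = 1
  AB : A * B = C
  BA : B * A = C

namespace IsLine
variable {A B C : Matrix (Fin (2 * 4)) (Fin (2 * 4)) ℂ}

theorem AC (h : IsLine A B C) : A * C = B := by rw [← h.AB, ← mul_assoc, h.AA, one_mul]
theorem CA (h : IsLine A B C) : C * A = B := by rw [← h.BA, mul_assoc, h.AA, mul_one]
theorem BC (h : IsLine A B C) : B * C = A := by rw [← h.BA, ← mul_assoc, h.BB, one_mul]
theorem CB (h : IsLine A B C) : C * B = A := by rw [← h.AB, mul_assoc, h.BB, mul_one]
theorem CC (h : IsLine A B C) : C * C = 1 := by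
  nth_rewrite 1 [← h.AB]; rw [mul_assoc, h.BC, h.AA]
theorem hC (h : IsLine A B C) : C.IsHermitian := by
  rw [Matrix.IsHermitian, ← h.AB, Matrix.conjTranspose_mul, h.hA, h.hB, h.AB, h.BA]

theorem facA (h : IsLine A B C) (s t : ℂ) :
    proj s t A B C = (1 / 4 : ℂ) • ((1 + s • A) * (1 + t • B)) := by
  simp only [proj, mul_add, add_mul, smul_mul_assoc, mul_smul_comm, one_mul, mul_one, h.AB]
  module
theorem facB (h : IsLine A B C) (s t : ℂ) :
    proj s t A B C = (1 / 4 : ℂ) • ((1 + t • B) * (1 + s • A)) := by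
  simp only [proj, mul_add, add_mul, smul_mul_assoc, mul_smul_comm, one_mul, mul_one, h.BA]
  module
theorem facC (h : IsLine A B C) {s : ℂ} (t : ℂ) (hs : s = 1 ∨ s = -1) :
    proj s t A B C = (1 / 4 : ℂ) • ((1 + (s * t) • C) * (1 + s • A)) := by
  simp only [proj, mul_add, add_mul, smul_mul_assoc, mul_smul_comm, one_mul, mul_one, h.CA]
  rcases hs with rfl | rfl <;> module
theorem facC' (h : IsLine A B C) {s : ℂ} (t : ℂ) (hs : s = 1 ∨ s = -1) :
    proj s t A B C = (1 / 4 : ℂ) • ((1 + s • A) * (1 + (s * t) • C)) := by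
  simp only [proj, mul_add, add_mul, smul_mul_assoc, mul_smul_comm, one_mul, mul_one, h.AC]
  rcases hs with rfl | rfl <;> module

theorem kill {s : ℂ} (hs : s = 1 ∨ s = -1) {X Y : Matrix (Fin (2 * 4)) (Fin (2 * 4)) ℂ}
    (hX : X * X = 1) (hY : X = -Y) : (1 + s • X) * (1 + s • Y) = 0 := by
  obtain rfl : Y = -X := by rw [hY, neg_neg]
  simp only [mul_add, add_mul, smul_mul_assoc, mul_smul_comm, one_mul, mul_one, mul_neg, hX]
  rcases hs with rfl | rfl <;> module

theorem idem (h : IsLine A B C) {s t : ℂ} (hs : s = 1 ∨ s = -1) (ht : t = 1 ∨ t = -1) :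
    proj s t A B C * proj s t A B C = proj s t A B C := by
  simp only [proj, mul_add, add_mul, smul_mul_assoc, mul_smul_comm, one_mul, mul_one, h.AA, h.AB,
    h.AC, h.BA, h.BB, h.BC, h.CA, h.CB, h.CC]
  rcases hs with rfl | rfl <;> rcases ht with rfl | rfl <;> module

theorem herm (h : IsLine A B C) {s t : ℂ} (hs : s = 1 ∨ s = -1) (ht : t = 1 ∨ t = -1) :
    (proj s t A B C).IsHermitian := by
  have e1 := h.hA.eq
  have e2 := h.hB.eq
  have e3 := h.hC.eq
  rw [Matrix.IsHermitian, proj]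
  simp only [Matrix.conjTranspose_smul, Matrix.conjTranspose_add, Matrix.conjTranspose_one, e1, e2,
    e3]
  rcases hs with rfl | rfl <;> rcases ht with rfl | rfl <;> simp
end IsLine

theorem smul_zero_mid {P Q R S : Matrix (Fin (2 * 4)) (Fin (2 * 4)) ℂ} (a b : ℂ) (h : Q * R = 0) :
    (a • (P * Q)) * (b • (R * S)) = 0 := by
  rw [smul_mul_smul_comm, mul_assoc, ← mul_assoc Q R S, h, zero_mul, mul_zero, smul_zero]

theorem line (v : Fin 21) : IsLine (cobs (obsA v)) (cobs (obsB v)) (cobs (obsC v)) where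
  hA := cobs_herm _ (obs_symA v)
  hB := cobs_herm _ (obs_symB v)
  AA := by
    rw [cobs_mul, obs_AA v]
    simp
  BB := by
    rw [cobs_mul, obs_BB v]
    simp
  AB := by
    rw [cobs_mul, obs_AB v]
    rfl
  BA := by
    rw [cobs_mul, obs_BA v]
    rfl

/-- The rank-2 quantum 4-colouring. -/
noncomputable def QE (v : Fin 21) (c : Fin 4) : Matrix (Fin (2 * 4)) (Fin (2 * 4)) ℂ :=
  proj (sA c) (sB c) (cobs (obsA v)) (cobs (obsB v)) (cobs (obsC v))

theorem QE_sum (v : Fin 21) : ∑ c, QE v c = 1 := by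
  rw [Fin.sum_univ_four]
  simp only [QE, proj, sA, sB, Matrix.cons_val]
  module

theorem sAB_pm (c : Fin 4) : sA c * sB c = 1 ∨ sA c * sB c = -1 := by
  rcases sA_pm c with h | h <;> rcases sB_pm c with h' | h' <;> simp [h, h']

theorem QE_orth (u v : Fin 21) (h : G21.Adj u v) (c : Fin 4) : QE u c * QE v c = 0 := by
  rcases h with h | h | h
  · rw [QE, QE, (line u).facB, (line v).facA]
    exact smul_zero_mid _ _ (IsLine.kill (sA_pm c) (line u).AA (by rw [h, cobs_neg]))
  · rw [QE, QE, (line u).facA, (line v).facB]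
    exact smul_zero_mid _ _ (IsLine.kill (sB_pm c) (line u).BB (by rw [h, cobs_neg]))
  · rw [QE, QE, (line u).facC' _ (sA_pm c), (line v).facC _ (sA_pm c)]
    exact smul_zero_mid _ _ (IsLine.kill (sAB_pm c) (line u).CC (by rw [h, cobs_neg]))

theorem QE_trace (v : Fin 21) (c : Fin 4) : (QE v c).trace = 2 := by
  simp only [QE, proj, Matrix.trace_smul, Matrix.trace_add, cobs_trace _ (obs_trA v),
    cobs_trace _ (obs_trB v), cobs_trace _ (obs_trC v), Matrix.trace_one, Fintype.card_fin]
  norm_num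

theorem QE_col : IsRankRQuantumColoring G21 2 4 QE := by
  refine ⟨⟨fun v c => (line v).herm (sA_pm c) (sB_pm c), fun v c => (line v).idem (sA_pm c) (sB_pm c),
    QE_sum, QE_orth⟩, fun v c => ?_⟩
  have h := trace_idem (QE v c) ((line v).idem (sA_pm c) (sB_pm c))
  rw [QE_trace] at h
  exact_mod_cast h.symm

/-- Adding zero coordinates to an orthogonal representation. -/
theorem rep_pad {G : SimpleGraph (Fin 21)} {k : ℕ} (m : ℕ) {ψ : Fin 21 → Fin k → ℂ}
    (h : IsOrthRep G k ψ) : ∃ φ : Fin 21 → Fin (k + m) → ℂ, IsOrthRep G (k + m) φ := by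
  have key : ∀ x y : Fin k → ℂ, cdot (Fin.append x (0 : Fin m → ℂ)) (Fin.append y (0 : Fin m → ℂ)) =
      cdot x y := by
    intro x y
    simp [cdot, Fin.sum_univ_add]
  refine ⟨fun v => Fin.append (ψ v) 0, fun v => ?_, fun u v huv => ?_⟩
  · rw [key, h.1]
  · rw [key, h.2 u v huv]

theorem no_rep_le (k : ℕ) (hk : k ≤ 4) : ¬ ∃ ψ : Fin 21 → Fin k → ℂ, IsOrthRep G21 k ψ := by
  rintro ⟨ψ, h⟩
  obtain ⟨m, hm⟩ := Nat.exists_eq_add_of_le hk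
  have := rep_pad m h
  rw [← hm] at this
  exact no_rep this

theorem rep_of_colorable {G : SimpleGraph (Fin 21)} {k : ℕ} (h : G.Colorable k) :
    ∃ ψ : Fin 21 → Fin k → ℂ, IsOrthRep G k ψ := by
  obtain ⟨C⟩ := h
  refine ⟨fun v => Pi.single (C v) 1, fun v => ?_, fun u v huv => ?_⟩
  · simp [cdot, Pi.single_apply]
  · have := C.valid huv
    simp [cdot, Pi.single_apply, this.symm]

/-- An explicit proper 5-colouring. -/
def col : Fin 21 → Fin 5 := ![0, 0, 1, 1, 0, 2, 3, 3, 0, 2, 2, 1, 1, 0, 3, 4, 4, 3, 3, 2, 1]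

theorem col_proper : ∀ u v, G21.Adj u v → col u ≠ col v := by decide +kernel

theorem colorable5 : G21.Colorable 5 := ⟨SimpleGraph.Coloring.mk col fun {u v} h => col_proper u v h⟩

theorem rep_normalise {G : SimpleGraph (Fin 21)} {k : ℕ} (x : Fin 21 → Fin k → ℂ)
    (hx : ∀ v, x v ≠ 0) (ho : ∀ u v, G.Adj u v → cdot (x u) (x v) = 0) :
    ∃ ψ : Fin 21 → Fin k → ℂ, IsOrthRep G k ψ := by
  let n : Fin 21 → ℝ := fun v => ∑ i, Complex.normSq (x v i)
  have hn : ∀ v, 0 < n v := by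
    intro v
    obtain ⟨i, hi⟩ := Function.ne_iff.mp (hx v)
    exact Finset.sum_pos' (fun i _ => Complex.normSq_nonneg _)
      ⟨i, Finset.mem_univ _, Complex.normSq_pos.mpr hi⟩
  have hc : ∀ v, cdot (x v) (x v) = (n v : ℂ) := by
    intro v
    simp only [cdot, n, Complex.ofReal_sum, Complex.normSq_eq_conj_mul_self]
  have hs : ∀ (a b : ℝ) (y z : Fin k → ℂ), cdot ((a : ℂ) • y) ((b : ℂ) • z) = a * b * cdot y z := by
    intro a b y z
    simp only [cdot, Finset.mul_sum]
    refine Finset.sum_congr rfl fun i _ => ?_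
    simp
    ring
  refine ⟨fun v => (((Real.sqrt (n v))⁻¹ : ℝ) : ℂ) • x v, fun v => ?_, fun u v huv => ?_⟩
  · rw [hs, hc, ← Complex.ofReal_mul, ← Complex.ofReal_mul, ← mul_inv,
      Real.mul_self_sqrt (hn v).le, inv_mul_cancel₀ (hn v).ne', Complex.ofReal_one]
  · rw [hs, ho u v huv, mul_zero]

theorem rep_of_rank_one {G : SimpleGraph (Fin 21)} {k : ℕ} (hk : 1 ≤ k)
    {E : Fin 21 → Fin k → Matrix (Fin (1 * k)) (Fin (1 * k)) ℂ}
    (hE : IsRankRQuantumColoring G 1 k E) : ∃ ψ : Fin 21 → Fin k → ℂ, IsOrthRep G k ψ := by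
  obtain ⟨⟨hh, -, -, ho⟩, hr⟩ := hE
  let c : Fin k := ⟨0, hk⟩
  have hne : ∀ v, ∃ j, (fun i => E v c i j) ≠ 0 := by
    intro v
    by_contra hcon
    push Not at hcon
    have : E v c = 0 := by
      ext i j
      exact congrFun (hcon j) i
    have h1 := hr v c
    rw [this, Matrix.rank_zero] at h1
    exact absurd h1 (by norm_num)
  choose j hj using hne
  have := rep_normalise (G := G) (fun v i => E v c i (j v)) hj (by
    intro u v huv
    have h0 : (E u c * E v c) (j u) (j v) = 0 := by rw [ho u v huv c]; rfl
    rw [Matrix.mul_apply] at h0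
    rw [cdot, ← h0]
    refine Finset.sum_congr rfl fun i _ => ?_
    rw [← (hh u c).apply (j u) i]
    rfl)
  rwa [one_mul] at this

/-- Coordinate projectors of rank one. -/
noncomputable def D (w : Fin 5) : Matrix (Fin (1 * 5)) (Fin (1 * 5)) ℂ :=
  Matrix.diagonal fun i => if i.val = w.val then 1 else 0

theorem D_mul (w w' : Fin 5) : D w * D w' = if w = w' then D w else 0 := by
  rw [D, D, Matrix.diagonal_mul_diagonal]
  split
  · next h => subst h; simp
  · next h =>
    rw [← Matrix.diagonal_zero]
    congr 1
    ext i
    have : w.val ≠ w'.val := fun h' => h (Fin.ext h')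
    by_cases h1 : i.val = w.val
    · simp [h1, this]
    · simp [h1]

theorem D_idem (w : Fin 5) : D w * D w = D w := by
  rw [D_mul, if_pos rfl]

theorem D_herm (w : Fin 5) : (D w).IsHermitian := by
  rw [Matrix.IsHermitian, D, Matrix.diagonal_conjTranspose]
  congr 1
  ext i
  by_cases h : i.val = w.val <;> simp [h]

theorem D_sum : ∑ w, D w = 1 := by
  ext i j
  rw [Matrix.sum_apply]
  by_cases hij : i = j
  · subst hij
    simp only [D, Matrix.diagonal_apply_eq, Matrix.one_apply_eq]
    rw [Fin.sum_univ_five]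
    fin_cases i <;> simp
  · simp [D, Matrix.diagonal_apply_ne _ hij, Matrix.one_apply_ne hij]

theorem D_trace (w : Fin 5) : (D w).trace = 1 := by
  rw [D, Matrix.trace_diagonal]
  change ∑ i : Fin 5, (if i.val = w.val then (1 : ℂ) else 0) = 1
  simp [← Fin.ext_iff]

theorem rank_one_five : IsRankRQuantumColoring G21 1 5 (fun v c => D (c + col v)) := by
  refine ⟨⟨fun v c => D_herm _, fun v c => D_idem _, fun v => ?_, fun u v huv c => ?_⟩, fun v c => ?_⟩
  · rw [← D_sum]
    exact Equiv.sum_comp (Equiv.addRight (col v)) D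
  · rw [D_mul, if_neg]
    exact fun h => col_proper u v huv (add_left_cancel h)
  · have h := trace_idem (D (c + col v)) (D_idem _)
    rw [D_trace] at h
    exact_mod_cast h.symm

theorem sInf_eq_of {P : ℕ → Prop} {n : ℕ} (hn : P n) (h : ∀ k, P k → n ≤ k) :
    sInf {k | P k} = n :=
  le_antisymm (Nat.sInf_le hn) (le_csInf ⟨n, hn⟩ fun k hk => h k hk)

theorem K4 : G21.IsNClique 4 ({1, 2, 15, 18} : Finset (Fin 21)) := by
  refine ⟨?_, by decide⟩
  have : ∀ u ∈ ({1, 2, 15, 18} : Finset (Fin 21)), ∀ v ∈ ({1, 2, 15, 18} : Finset (Fin 21)),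
      u ≠ v → G21.Adj u v := by decide
  exact fun u hu v hv hne => this u hu v hv hne

theorem four_le {k d : ℕ} (hd : 1 ≤ d) {E : Fin 21 → Fin k → Matrix (Fin d) (Fin d) ℂ}
    (hE : IsQuantumColoring G21 k d E) : 4 ≤ k := by
  have := clique_le hd hE _ K4.isClique
  rwa [K4.card_eq] at this

/-- there is a graph `G` on 21 vertices with clique number 4,
admitting a rank-2 quantum 4-colouring (hence `χ_q(G) = χ_q^{(2)}(G) = 4`),
with chromatic number 5, and admitting no 4-dimensional complex orthogonal
representation (hence `ξ(G) = 5` and `χ_q^{(1)}(G) = 5`). -/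
theorem exists_graph_21 :
    ∃ G : SimpleGraph (Fin 21),
      cliqueNum' G = 4 ∧
      (∃ E : Fin 21 → Fin 4 → Matrix (Fin (2 * 4)) (Fin (2 * 4)) ℂ,
        IsRankRQuantumColoring G 2 4 E) ∧
      quantumChromaticNumber G = 4 ∧
      rankChromaticNumber G 2 = 4 ∧
      chromNat G = 5 ∧
      (¬ ∃ ψ : Fin 21 → Fin 4 → ℂ, IsOrthRep G 4 ψ) ∧
      orthRank G = 5 ∧
      rankChromaticNumber G 1 = 5 := by
  refine ⟨G21, ?_, ⟨QE, QE_col⟩, ?_, ?_, ?_, no_rep, ?_, ?_⟩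
  · have hub : ∀ n ∈ {n | ∃ S : Finset (Fin 21), G21.IsNClique n S}, n ≤ 4 := by
      rintro n ⟨S, hS⟩
      have := clique_le (by norm_num) QE_col.1 S hS.isClique
      rwa [hS.card_eq] at this
    exact le_antisymm (csSup_le ⟨4, _, K4⟩ hub) (le_csSup ⟨4, hub⟩ ⟨_, K4⟩)
  · refine sInf_eq_of ⟨by norm_num, 2 * 4, by norm_num, QE, QE_col.1⟩ ?_
    rintro k ⟨-, d, hd, E, hE⟩
    exact four_le hd hE
  · refine sInf_eq_of ⟨by norm_num, QE, QE_col⟩ ?_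
    rintro k ⟨hk, E, hE⟩
    exact four_le (by omega) hE.1
  · refine sInf_eq_of ⟨by norm_num, colorable5⟩ ?_
    rintro k ⟨-, hk⟩
    by_contra hlt
    exact no_rep_le k (by omega) (rep_of_colorable hk)
  · refine sInf_eq_of ⟨by norm_num, rep_of_colorable colorable5⟩ ?_
    rintro k ⟨-, hk⟩
    by_contra hlt
    exact no_rep_le k (by omega) hk
  · refine sInf_eq_of ⟨by norm_num, _, rank_one_five⟩ ?_
    rintro k ⟨hk, E, hE⟩
    by_contra hlt
    exact no_rep_le k (by omega) (rep_of_rank_one hk hE)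
end

section
/- Let G be a finite simple graph, and r, k ≥ 1. If G admits an (r,k)-clump representation, then G admits a rank-r quantum k²-colouring. In particular χ_q^{(r)}(G) ≤ ξ_c^{(r)}(G)². -/
open scoped ComplexConjugate

/-- An `(r,k)`-vector clump: `r*k` pairwise orthogonal unit vectors in `ℂ^(r*k)`. -/
def IsClump (r k : ℕ) (ψ : Fin r → Fin k → Fin (r * k) → ℂ) : Prop :=
  ∀ i j i' j', cdot (ψ i j) (ψ i' j') = if i = i' ∧ j = j' then (1 : ℂ) else 0

/-- Orthogonality of two `(r,k)`-clumps. -/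
def ClumpOrthogonal (r k : ℕ) (ψ φ : Fin r → Fin k → Fin (r * k) → ℂ) : Prop :=
  ∀ i i', ∑ j, cdot (ψ i j) (φ i' j) = 0

/-- An `(r,k)`-clump representation of `G`. -/
def IsClumpRep {V : Type} (G : SimpleGraph V) (r k : ℕ)
    (ψ : V → Fin r → Fin k → Fin (r * k) → ℂ) : Prop :=
  (∀ v, IsClump r k (ψ v)) ∧ ∀ u v, G.Adj u v → ClumpOrthogonal r k (ψ u) (ψ v)

/-- The rank-`r` clump rank `ξ_c^{(r)}(G)`. -/
noncomputable def clumpRank {V : Type} (G : SimpleGraph V) (r : ℕ) : ℕ :=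
  sInf {k | 1 ≤ k ∧ ∃ ψ, IsClumpRep G r k ψ}

theorem exists_fourier (k : ℕ) [NeZero k] : ∃ F : Fin k → Fin k → ℂ,
    (∀ a j, conj (F a j) * F a j = (k : ℂ)⁻¹) ∧
    ∀ a a', ∑ j, conj (F a j) * F a' j = if a = a' then 1 else 0 := by
  obtain ⟨n, rfl⟩ : ∃ n, k = n + 1 := ⟨k - 1, by have := NeZero.ne k; omega⟩
  have hs : ((Real.sqrt ((n + 1 : ℕ) : ℝ) : ℝ) : ℂ)⁻¹ * ((Real.sqrt ((n + 1 : ℕ) : ℝ) : ℝ) : ℂ)⁻¹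
      = ((n + 1 : ℕ) : ℂ)⁻¹ := by
    rw [← mul_inv, ← Complex.ofReal_mul, Real.mul_self_sqrt (by positivity)]
    simp
  have key : ∀ a a' j : ZMod (n + 1),
      conj (((Real.sqrt ((n + 1 : ℕ) : ℝ) : ℝ) : ℂ)⁻¹ * ZMod.stdAddChar (a * j)) *
        (((Real.sqrt ((n + 1 : ℕ) : ℝ) : ℝ) : ℂ)⁻¹ * ZMod.stdAddChar (a' * j)) =
      ((n + 1 : ℕ) : ℂ)⁻¹ * ZMod.stdAddChar (j * (a' - a)) := by
    intro a a' j
    rw [map_mul, ← AddChar.map_neg_eq_conj, map_inv₀, Complex.conj_ofReal, mul_mul_mul_comm, hs,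
      ← AddChar.map_add_eq_mul]
    congr 2
    ring
  have z : ∃ F : ZMod (n + 1) → ZMod (n + 1) → ℂ,
      (∀ a j, conj (F a j) * F a j = ((n + 1 : ℕ) : ℂ)⁻¹) ∧
      ∀ a a', ∑ j, conj (F a j) * F a' j = if a = a' then 1 else 0 := by
    refine ⟨fun a j => ((Real.sqrt ((n + 1 : ℕ) : ℝ) : ℝ) : ℂ)⁻¹ *
      ZMod.stdAddChar (a * j), ?_, ?_⟩
    · intro a j
      refine (key a a j).trans ?_
      simp
    · intro a a'
      refine (Finset.sum_congr rfl fun j _ => key a a' j).trans ?_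
      rw [← Finset.mul_sum, AddChar.sum_mulShift _ (ZMod.isPrimitive_stdAddChar (n + 1)), ZMod.card]
      by_cases h : a = a'
      · subst h
        rw [if_pos (sub_self a), if_pos rfl]
        exact inv_mul_cancel₀ (by exact_mod_cast Nat.succ_ne_zero n)
      · rw [if_neg h, if_neg (fun h2 => h (sub_eq_zero.1 h2).symm)]
        simp
  exact z

open scoped ComplexOrder in
theorem coloring_of_vectors {V : Type} (G : SimpleGraph V) (r k : ℕ)
    (Ψ : V → Fin r → Fin k → Fin (r * k) → ℂ) 
    (h1 : ∀ v i c i' c', cdot (Ψ v i c) (Ψ v i' c') = if i = i' ∧ c = c' then (1 : ℂ) else 0)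
    (h2 : ∀ u v, G.Adj u v → ∀ c i i', cdot (Ψ u i c) (Ψ v i' c) = 0) :
    ∃ E : V → Fin k → Matrix (Fin (r * k)) (Fin (r * k)) ℂ,
        IsRankRQuantumColoring G r k E := by
  let A : V → Fin k → Matrix (Fin (r * k)) (Fin r) ℂ := fun v c => Matrix.of fun x i => Ψ v i c x
  have hA : ∀ u v c c' i i', ((A u c).conjTranspose * A v c') i i' = cdot (Ψ u i c) (Ψ v i' c') := by
    intro u v c c' i i'
    simp [A, Matrix.mul_apply, cdot]
  have hA1 : ∀ v c, (A v c).conjTranspose * A v c = 1 := by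
    intro v c
    ext i i'
    rw [hA, h1]
    simp [Matrix.one_apply]
  refine ⟨fun v c => A v c * (A v c).conjTranspose, ⟨?_, ?_, ?_, ?_⟩, ?_⟩
  · intro v c
    exact Matrix.isHermitian_mul_conjTranspose_self _
  · intro v c
    simp only
    rw [Matrix.mul_assoc, ← Matrix.mul_assoc _ (A v c), hA1, Matrix.one_mul]
  · intro v
    let U : Matrix (Fin (r * k)) (Fin r × Fin k) ℂ := Matrix.of fun x p => Ψ v p.1 p.2 x
    have hU : U.conjTranspose * U = 1 := by
      ext ⟨i, c⟩ ⟨i', c'⟩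
      have := h1 v i c i' c'
      simp only [cdot] at this
      simp [U, Matrix.mul_apply, Matrix.one_apply, this]
    have hU2 : U * U.conjTranspose = 1 :=
      (Matrix.mul_eq_one_comm_of_equiv finProdFinEquiv).1 hU
    rw [← hU2]
    ext x y
    simp [Matrix.sum_apply, Matrix.mul_apply, U, A, Fintype.sum_prod_type_right]
  · intro u v huv c
    have : (A u c).conjTranspose * A v c = 0 := by
      ext i i'
      rw [hA, h2 u v huv]
      rfl
    simp only
    rw [Matrix.mul_assoc, ← Matrix.mul_assoc _ (A v c), this, Matrix.zero_mul, Matrix.mul_zero]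
  · intro v c
    simp only
    rw [Matrix.rank_self_mul_conjTranspose, ← Matrix.rank_conjTranspose_mul_self, hA1]
    simp

theorem coloring_of_clump {V : Type} (G : SimpleGraph V) (r k : ℕ) [NeZero k]
    (ψ : V → Fin r → Fin k → Fin (r * k) → ℂ) (hψ : IsClumpRep G r k ψ) :
    ∃ E : V → Fin (k * k) → Matrix (Fin (r * (k * k))) (Fin (r * (k * k))) ℂ,
        IsRankRQuantumColoring G r (k * k) E := by
  obtain ⟨F, hF1, hF2⟩ := exists_fourier k
  let e : Fin (r * (k * k)) ≃ Fin k × Fin (r * k) :=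
    ((finCongr (by ring)).trans finProdFinEquiv.symm)
  let q : Fin (k * k) ≃ Fin k × Fin k := finProdFinEquiv.symm
  let Ψ : V → Fin r → Fin (k * k) → Fin (r * (k * k)) → ℂ := fun v i c x =>
    F (q c).1 ((e x).1 - (q c).2) * ψ v i ((e x).1 - (q c).2) (e x).2
  have main : ∀ u v i c i' c', cdot (Ψ u i c) (Ψ v i' c') =
      ∑ z, conj (F (q c).1 (z - (q c).2)) * F (q c').1 (z - (q c').2) *
        cdot (ψ u i (z - (q c).2)) (ψ v i' (z - (q c').2)) := by
    intro u v i c i' c'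
    simp only [cdot, Ψ]
    rw [← e.symm.sum_comp, Fintype.sum_prod_type]
    refine Finset.sum_congr rfl fun z _ => ?_
    rw [Finset.mul_sum]
    refine Finset.sum_congr rfl fun y _ => ?_
    simp only [Equiv.apply_symm_apply, map_mul]
    ring
  refine coloring_of_vectors G r (k * k) Ψ ?_ ?_
  · intro v i c i' c'
    rw [main]
    simp only [hψ.1 v _ _ _ _, sub_right_inj]
    by_cases hi : i = i'
    · by_cases hb : (q c).2 = (q c').2
      · have : (c = c') ↔ (q c).1 = (q c').1 := by
          rw [← q.injective.eq_iff, Prod.ext_iff]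
          simp [hb]
        simp only [hi, hb, this, true_and, and_self, if_true, mul_one]
        rw [← hF2]
        exact (Equiv.subRight (q c').2).sum_comp (fun j => conj (F (q c).1 j) * F (q c').1 j)
      · have : c ≠ c' := fun h => hb (by rw [h])
        simp [hb, this]
    · simp [hi]
  · intro u v huv c i i'
    rw [main]
    simp only [hF1]
    rw [← Finset.mul_sum]
    have := (Equiv.subRight (q c).2).sum_comp (fun j => cdot (ψ u i j) (ψ v i' j))
    simp only [Equiv.subRight_apply] at this
    rw [this, hψ.2 u v huv, mul_zero]

theorem exists_clump {V : Type} [Fintype V] (G : SimpleGraph V) (r : ℕ) :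
    ∃ k, 1 ≤ k ∧ ∃ ψ, IsClumpRep G r k ψ := by
  classical
  let n := Fintype.card V
  let f : V → Fin (n + 1) := fun v => (Fintype.equivFin V v).castSucc
  have hf : Function.Injective f :=
    (Fin.castSucc_injective n).comp (Fintype.equivFin V).injective
  have hc : ∀ p q : Fin r × Fin (n + 1), cdot (Pi.single (finProdFinEquiv p) (1 : ℂ))
      (Pi.single (finProdFinEquiv q) (1 : ℂ)) = if p = q then 1 else 0 := by
    intro p q
    simp only [cdot, Pi.single_apply, apply_ite conj, map_one, map_zero, ite_mul, one_mul,
      zero_mul, Finset.sum_ite_eq', Finset.mem_univ, if_true, Finset.sum_ite_eq,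
      finProdFinEquiv.injective.eq_iff]
  refine ⟨n + 1, by omega, fun v i j => Pi.single (finProdFinEquiv (i, j + f v)) 1, ?_, ?_⟩
  · intro v i j i' j'
    rw [hc]
    simp
  · intro u v huv i i'
    refine Finset.sum_eq_zero fun j _ => ?_
    rw [hc, if_neg]
    intro h
    simp only [Prod.mk.injEq, add_right_inj] at h
    exact huv.ne (hf h.2)

/-- an `(r,k)`-clump representation yields a rank-`r` quantum
`k²`-colouring; in particular `χ_q^{(r)}(G) ≤ ξ_c^{(r)}(G)²`. -/
theorem rankChromaticNumber_le_clumpRank_sq {V : Type} [Fintype V]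
    (G : SimpleGraph V) (r k : ℕ) (hr : 1 ≤ r) (hk : 1 ≤ k) :
    ((∃ ψ : V → Fin r → Fin k → Fin (r * k) → ℂ, IsClumpRep G r k ψ) →
      ∃ E : V → Fin (k * k) → Matrix (Fin (r * (k * k))) (Fin (r * (k * k))) ℂ,
        IsRankRQuantumColoring G r (k * k) E) ∧
    rankChromaticNumber G r ≤ clumpRank G r ^ 2 := by
  constructor
  · rintro ⟨ψ, hψ⟩
    have : NeZero k := ⟨by omega⟩
    exact coloring_of_clump G r k ψ hψ
  · obtain ⟨h1, ψ, hψ⟩ := Nat.sInf_mem (s := {k | 1 ≤ k ∧ ∃ ψ, IsClumpRep G r k ψ})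
      (exists_clump G r)
    change 1 ≤ clumpRank G r at h1
    have : NeZero (clumpRank G r) := ⟨by omega⟩
    obtain ⟨E, hE⟩ := coloring_of_clump G r (clumpRank G r) ψ hψ
    rw [pow_two]
    exact Nat.sInf_le ⟨Nat.mul_pos h1 h1, E, hE⟩
end
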